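/- Let s ∈ (0,1) be irrational with continued fraction coefficients a_1, a_2, … and convergents p_n/q_n. Then for every n ≥ 1, |q_n·s − p_n| ≥ a_{n+2}/((a_{n+2}+1)·(a_{n+1}+1)·q_n). -/

import Mathlib

/-- The Gauss map `G(x) = 1/x − ⌊1/x⌋`. -/
noncomputable def gaussMap (x : ℝ) : ℝ := Int.fract x⁻¹

/-- The `k`-th continued fraction coefficient `a_k(x) = ⌊1/G^(k−1)(x)⌋` (for `k ≥ 1`). -/
noncomputable def cfCoeff (x : ℝ) (k : ℕ) : ℤ := ⌊(gaussMap^[k - 1] x)⁻¹⌋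

/-- Numerators of the convergents: `p₀ = 0`, `p₁ = 1`, `p_{n+2} = a_{n+2}·p_{n+1} + p_n`. -/
def pSeq (a : ℕ → ℤ) : ℕ → ℤ
  | 0 => 0
  | 1 => 1
  | n + 2 => a (n + 2) * pSeq a (n + 1) + pSeq a n

/-- Denominators of the convergents: `q₀ = 1`, `q₁ = a₁`, `q_{n+2} = a_{n+2}·q_{n+1} + q_n`. -/
def qSeq (a : ℕ → ℤ) : ℕ → ℤ
  | 0 => 1
  | 1 => a 1
  | n + 2 => a (n + 2) * qSeq a (n + 1) + qSeq a n

theorem irrational_gaussMap {x : ℝ} (hx : Irrational x) : Irrational (gaussMap x) := by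
  have h : Irrational (x⁻¹ - (⌊x⁻¹⌋ : ℝ)) := hx.inv.sub_intCast _
  exact h

theorem irrational_gaussMap_iterate {x : ℝ} (hx : Irrational x) (n : ℕ) :
    Irrational (gaussMap^[n] x) := by
  induction n with
  | zero => exact hx
  | succ n ih =>
    rw [Function.iterate_succ_apply']
    exact irrational_gaussMap ih

theorem gaussMap_iterate_mem_Ioo {x : ℝ} (hx : Irrational x) (h01 : x ∈ Set.Ioo (0 : ℝ) 1)
    (n : ℕ) : gaussMap^[n] x ∈ Set.Ioo (0 : ℝ) 1 := by
  cases n with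
  | zero => exact h01
  | succ n =>
    have hne := (irrational_gaussMap_iterate hx (n + 1)).ne_zero
    rw [Function.iterate_succ_apply'] at hne ⊢
    exact ⟨lt_of_le_of_ne (Int.fract_nonneg _) hne.symm, Int.fract_lt_one _⟩

theorem cfCoeff_succ_add_gaussMap_iterate (x : ℝ) (n : ℕ) :
    (cfCoeff x (n + 1) : ℝ) + gaussMap^[n + 1] x = (gaussMap^[n] x)⁻¹ := by
  rw [Function.iterate_succ_apply']
  exact Int.floor_add_fract _

theorem gaussMap_iterate_mul {x : ℝ} (hx : Irrational x) (n : ℕ) :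
    gaussMap^[n] x * ((cfCoeff x (n + 1) : ℝ) + gaussMap^[n + 1] x) = 1 := by
  rw [cfCoeff_succ_add_gaussMap_iterate,
    mul_inv_cancel₀ (irrational_gaussMap_iterate hx n).ne_zero]

theorem one_le_cfCoeff_succ {x : ℝ} (hx : Irrational x) (h01 : x ∈ Set.Ioo (0 : ℝ) 1) (n : ℕ) :
    1 ≤ cfCoeff x (n + 1) := by
  obtain ⟨h0, h1⟩ := gaussMap_iterate_mem_Ioo hx h01 n
  refine Int.le_floor.mpr ?_
  simpa using (one_lt_inv₀ h0).mpr h1 |>.le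

theorem qSeq_pos_and_le_succ {a : ℕ → ℤ} (ha : ∀ n, 1 ≤ a (n + 1)) (n : ℕ) :
    0 < qSeq a n ∧ qSeq a n ≤ qSeq a (n + 1) := by
  induction n with
  | zero => exact ⟨one_pos, ha 0⟩
  | succ n ih =>
    refine ⟨ih.1.trans_le ih.2, ?_⟩
    rw [qSeq]
    nlinarith [ha (n + 1)]

/-- The signed approximation error `q_n·x − p_n` is, up to the sign `(-1)^n`, the product
`x·G(x)⋯Gⁿ(x)`. -/
theorem qSeq_mul_sub_pSeq {x : ℝ} (hx : Irrational x) (n : ℕ) :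
    (qSeq (cfCoeff x) n : ℝ) * x - pSeq (cfCoeff x) n =
      (-1) ^ n * ∏ i ∈ Finset.range (n + 1), gaussMap^[i] x := by
  induction n using Nat.twoStepInduction with
  | zero => simp [qSeq, pSeq]
  | one =>
    have h := gaussMap_iterate_mul hx 0
    simp only [Finset.prod_range_succ, Finset.prod_range_zero, qSeq, pSeq]
    simp only [zero_add, Function.iterate_zero, id_eq] at h ⊢
    push_cast
    linear_combination h
  | more n ih0 ih1 =>
    have h := gaussMap_iterate_mul hx (n + 1)
    rw [Finset.prod_range_succ] at ih1
    rw [Finset.prod_range_succ, Finset.prod_range_succ, qSeq, pSeq]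
    push_cast
    linear_combination (cfCoeff x (n + 2) : ℝ) * ih1 + ih0 -
      (-1) ^ n * (∏ i ∈ Finset.range (n + 1), gaussMap^[i] x) * h

theorem prod_gaussMap_iterate_mul_qSeq {x : ℝ} (hx : Irrational x) (n : ℕ) :
    (∏ i ∈ Finset.range (n + 1), gaussMap^[i] x) *
      ((qSeq (cfCoeff x) (n + 1) : ℝ) + qSeq (cfCoeff x) n * gaussMap^[n + 1] x) = 1 := by
  induction n with
  | zero =>
    have h := gaussMap_iterate_mul hx 0
    simpa [qSeq] using h
  | succ n ih =>
    have h := gaussMap_iterate_mul hx (n + 1)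
    rw [Finset.prod_range_succ, qSeq]
    push_cast
    linear_combination ih + (∏ i ∈ Finset.range (n + 1), gaussMap^[i] x) *
      qSeq (cfCoeff x) (n + 1) * h

/-- for an irrational `s ∈ (0,1)` with continued fraction coefficients `a_k`
and convergents `p_n/q_n`, for every `n ≥ 1`,
`|q_n·s − p_n| ≥ a_{n+2}/((a_{n+2}+1)·(a_{n+1}+1)·q_n)`. -/
theorem stmt17 (s : ℝ) (hs : Irrational s) (h01 : s ∈ Set.Ioo (0 : ℝ) 1)
    (n : ℕ) (hn : 1 ≤ n) :
    (cfCoeff s (n + 2) : ℝ) /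
        (((cfCoeff s (n + 2) : ℝ) + 1) * ((cfCoeff s (n + 1) : ℝ) + 1) *
          (qSeq (cfCoeff s) n : ℝ)) ≤
      |(qSeq (cfCoeff s) n : ℝ) * s - (pSeq (cfCoeff s) n : ℝ)| := by
  obtain ⟨m, rfl⟩ := Nat.exists_eq_add_of_le' hn
  have ht := gaussMap_iterate_mem_Ioo hs h01
  have hprod := prod_gaussMap_iterate_mul_qSeq hs (m + 1)
  have hgauss := gaussMap_iterate_mul hs (m + 2)
  rw [qSeq_mul_sub_pSeq hs, abs_mul, abs_pow, abs_neg, abs_one, one_pow, one_mul,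
    abs_of_pos (Finset.prod_pos fun i _ => (ht i).1)]
  have hD : 0 < ∏ i ∈ Finset.range (m + 1 + 1), gaussMap^[i] s :=
    Finset.prod_pos fun i _ => (ht i).1
  have ha : (1 : ℝ) ≤ cfCoeff s (m + 2) := mod_cast one_le_cfCoeff_succ hs h01 (m + 1)
  have hb : (1 : ℝ) ≤ cfCoeff s (m + 3) := mod_cast one_le_cfCoeff_succ hs h01 (m + 2)
  have hq := qSeq_pos_and_le_succ (one_le_cfCoeff_succ hs h01) m
  have hq0 : (0 : ℝ) < qSeq (cfCoeff s) m := mod_cast hq.1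
  have hqle : (qSeq (cfCoeff s) m : ℝ) ≤ qSeq (cfCoeff s) (m + 1) := mod_cast hq.2
  have h0 := (ht (m + 2)).1
  have h0' := (ht (m + 3)).1
  rw [qSeq] at hprod
  push_cast at hprod
  simp only [add_assoc, Nat.reduceAdd] at hprod hgauss hD ⊢
  generalize (∏ i ∈ Finset.range (m + 2), gaussMap^[i] s) = D at *
  generalize (cfCoeff s (m + 2) : ℝ) = a at *
  generalize (cfCoeff s (m + 3) : ℝ) = b at *
  generalize (qSeq (cfCoeff s) (m + 1) : ℝ) = q at *
  generalize (qSeq (cfCoeff s) m : ℝ) = r at *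
  generalize gaussMap^[m + 2] s = t at *
  generalize gaussMap^[m + 3] s = u at *
  have hqpos : 0 < q := hq0.trans_le hqle
  have hbt : b * t ≤ 1 := by nlinarith
  have key : b * (a * q + (r + q * t)) ≤ (b + 1) * (a + 1) * q := by
    nlinarith [mul_le_mul_of_nonneg_left hbt hqpos.le,
      mul_le_mul_of_nonneg_left hqle (zero_le_one.trans hb), mul_pos (zero_lt_one.trans_le ha) hqpos]
  rw [div_le_iff₀ (by positivity)]
  calc b = D * (b * (a * q + (r + q * t))) := by linear_combination -b * hprod
    _ ≤ D * ((b + 1) * (a + 1) * q) := mul_le_mul_of_nonneg_left key hD.le
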